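/- There exists a Legendre pair (A, B) of length 129 such that moreover the sets I_A = {i ∈ ℤ_129 : a_i = 1} and I_B = {i ∈ ℤ_129 : b_i = 1} are each invariant under multiplication by 49 modulo 129 (so that the multiplier group of each sequence contains the order-3 subgroup {1, 49, 79} of ℤ_129*). -/

import Mathlib

/-- The periodic autocorrelation function of a sequence indexed by `ℤ_ℓ`:
`PAF(A,s) = ∑_{i} a_i a_{i+s}`. -/
def paf (ℓ : ℕ) [NeZero ℓ] (a : ZMod ℓ → ℤ) (s : ZMod ℓ) : ℤ :=
  ∑ i : ZMod ℓ, a i * a (i + s)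

/-- Two `±1` sequences indexed by `ℤ_ℓ` with entry sums equal to 1 form a Legendre pair
if `PAF(A,s) + PAF(B,s) = -2` for all `s = 1, …, (ℓ-1)/2`. -/
def IsLegendrePair (ℓ : ℕ) [NeZero ℓ] (a b : ZMod ℓ → ℤ) : Prop :=
  (∀ i, a i = 1 ∨ a i = -1) ∧
  (∀ i, b i = 1 ∨ b i = -1) ∧
  (∑ i : ZMod ℓ, a i = 1) ∧
  (∑ i : ZMod ℓ, b i = 1) ∧
  (∀ s : ℕ, 1 ≤ s → s ≤ (ℓ - 1) / 2 → paf ℓ a (s : ZMod ℓ) + paf ℓ b (s : ZMod ℓ) = -2)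

/-- The `±1` sequence of length `ℓ` whose entry at `i` is `1` iff the `i`-th binary digit of `m`
is `1`. -/
def signSeq (ℓ m : ℕ) (i : ZMod ℓ) : ℤ := if m.testBit i.val then 1 else -1

theorem signSeq_eq_one_or (ℓ m : ℕ) (i : ZMod ℓ) : signSeq ℓ m i = 1 ∨ signSeq ℓ m i = -1 := by
  unfold signSeq
  split <;> simp

/-- If `f` is invariant under left multiplication by a right-invertible `u`, then so are its
level sets. -/
theorem image_mul_left_levelSet_eq {R β : Type*} [Monoid R] {f : R → β} {u v : R}
    (huv : u * v = 1) (hf : ∀ i, f (u * i) = f i) (c : β) :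
    (fun i => u * i) '' {i | f i = c} = {i | f i = c} := by
  ext i
  constructor
  · rintro ⟨j, hj, rfl⟩
    exact (hf j).trans hj
  · intro hi
    have h : u * (v * i) = i := by rw [← mul_assoc, huv, one_mul]
    exact ⟨v * i, by rw [Set.mem_ofPred_eq, ← hf, h]; exact hi, h⟩

/-- The first sequence of the pair; its binary code is a union of orbits of `{1, 49, 79}`. -/
abbrev legendreA : ZMod 129 → ℤ := signSeq 129 11279771384264950616110387374092541744

/-- The second sequence of the pair; its binary code is a union of orbits of `{1, 49, 79}`. -/
abbrev legendreB : ZMod 129 → ℤ := signSeq 129 589081707792443687682273642955226166484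

set_option maxRecDepth 10000 in
theorem paf_legendreA_add_paf_legendreB : ∀ s ∈ Finset.Icc 1 64,
    paf 129 legendreA ((s : ℕ) : ZMod 129) + paf 129 legendreB ((s : ℕ) : ZMod 129) = -2 := by
  decide +kernel

/-- There exists a Legendre pair `(A,B)` of length 129 such that the sets
`I_A = {i : a_i = 1}` and `I_B = {i : b_i = 1}` are each invariant under multiplication
by 49 modulo 129 (so the multiplier group of each sequence contains the order-3
subgroup {1, 49, 79} of `ℤ_129*`). -/
theorem legendre_pair_129_exists :
    ∃ a b : ZMod 129 → ℤ, IsLegendrePair 129 a b ∧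
      (fun i => (49 : ZMod 129) * i) '' {i | a i = 1} = {i | a i = 1} ∧
      (fun i => (49 : ZMod 129) * i) '' {i | b i = 1} = {i | b i = 1} := by
  refine ⟨legendreA, legendreB, ⟨signSeq_eq_one_or _ _, signSeq_eq_one_or _ _, by decide +kernel,
    by decide +kernel, fun s h₁ h₂ => ?_⟩, ?_, ?_⟩
  · exact paf_legendreA_add_paf_legendreB s (Finset.mem_Icc.mpr ⟨h₁, h₂⟩)
  all_goals exact image_mul_left_levelSet_eq (v := 79) (by decide) (by decide +kernel) 1
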